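/- Let A = {a_1,…,a_p}, p ≥ 2, be distinct points, f ∈ 𝓛_A, and let P_n, Q_n ∈ 𝒫_n, Q_n not identically zero, be Padé polynomials of order n for f, with remainder R_n = Q_n f − P_n = O(z^{−(n+1)}) as z → ∞. Then R_n is not identically zero and its order of vanishing at infinity is at most n + p − 1; that is, R_n(z) = M_n z^{−(n+1+ℓ_n)} (1 + O(1/z)) as z → ∞ with M_n ≠ 0 and 0 ≤ ℓ_n ≤ p − 2 (all indices are 'almost perfect'). -/

import Mathlib

open Polynomial Filter Asymptotics Bornology Topology

lemma aux_ne0 : ∀ᶠ z : ℂ in cobounded ℂ, z ≠ 0 := eventually_ne_cobounded 0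

lemma aux_pow_le {k n : ℕ} (h : k ≤ n) :
    (fun z : ℂ => z ^ k) =O[cobounded ℂ] fun z => z ^ n := by
  refine IsBigO.of_bound 1 ?_
  have h1 : ∀ᶠ z : ℂ in cobounded ℂ, 1 ≤ ‖z‖ :=
    tendsto_norm_cobounded_atTop.eventually_ge_atTop 1
  filter_upwards [h1] with z hz
  rw [norm_pow, norm_pow, one_mul]
  exact pow_le_pow_right₀ hz h

lemma aux_poly (P : Polynomial ℂ) {n : ℕ} (h : P.natDegree ≤ n) :
    (fun z : ℂ => P.eval z) =O[cobounded ℂ] fun z => z ^ n := by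
  simp_rw [P.eval_eq_sum_range]
  refine IsBigO.fun_sum (fun i hi => ?_)
  refine IsBigO.const_mul_left (aux_pow_le ?_) _
  have := Finset.mem_range.1 hi
  omega

lemma aux_powinv {k m : ℕ} (h : k < m) :
    (fun z : ℂ => z ^ k * (z⁻¹) ^ m) =O[cobounded ℂ] fun z => z⁻¹ := by
  have h0 : (fun z : ℂ => z ^ k * (z⁻¹) ^ m) =O[cobounded ℂ]
      (fun z : ℂ => z ^ (m - 1) * (z⁻¹) ^ m) :=
    (aux_pow_le (by omega)).mul (isBigO_refl _ _)
  refine h0.trans (EventuallyEq.isBigO ?_)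
  filter_upwards [aux_ne0] with z hz
  obtain ⟨j, rfl⟩ : ∃ j, m = j + 1 := ⟨m - 1, by omega⟩
  simp only [Nat.add_sub_cancel]
  rw [pow_succ, ← mul_assoc, ← mul_pow, mul_inv_cancel₀ hz, one_pow, one_mul]

lemma aux_inv_tendsto : Tendsto (fun z : ℂ => z⁻¹) (cobounded ℂ) (𝓝 0) :=
  tendsto_inv₀_cobounded

lemma aux_poly_zero (W : Polynomial ℂ)
    (h : (fun z : ℂ => W.eval z) =O[cobounded ℂ] fun z => z⁻¹) : W = 0 := by
  have ht : Tendsto (fun z : ℂ => W.eval z) (cobounded ℂ) (𝓝 0) :=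
    h.trans_tendsto aux_inv_tendsto
  by_cases hd : 0 < W.degree
  · have h2 := W.tendsto_norm_atTop hd (tendsto_norm_cobounded_atTop (E := ℂ))
    exact absurd ht.norm (not_tendsto_nhds_of_tendsto_atTop h2 _)
  · rw [eq_C_of_degree_le_zero (not_lt.1 hd)] at ht ⊢
    simp only [eval_C] at ht
    have := tendsto_nhds_unique ht tendsto_const_nhds
    rw [← this, C_0]

lemma aux_dpow (a : ℂ) (r : ℕ) :
    (X - C a) * derivative ((X - C a) ^ r) = C (r : ℂ) * (X - C a) ^ r := by
  cases r with
  | zero => simp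
  | succ r =>
    rw [derivative_X_sub_C_pow]
    simp only [Nat.add_sub_cancel, map_natCast]
    ring

lemma aux_W (A1 B P Q : Polynomial ℂ) (a α : ℂ) (hα : ∀ m : ℤ, α ≠ (m : ℂ))
    (hP : P ≠ 0) (hQ : Q ≠ 0) (hA1 : A1.eval a ≠ 0) (hB : B.eval a = α * A1.eval a)
    (hW : (X - C a) * A1 * (derivative Q * P - Q * derivative P) + B * P * Q = 0) : False := by
  obtain ⟨P1, hP1, hP1'⟩ := exists_eq_pow_rootMultiplicity_mul_and_not_dvd P hP a
  obtain ⟨Q1, hQ1, hQ1'⟩ := exists_eq_pow_rootMultiplicity_mul_and_not_dvd Q hQ a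
  generalize rootMultiplicity a P = r at *
  generalize rootMultiplicity a Q = s at *
  rw [dvd_iff_isRoot, IsRoot.def] at hP1' hQ1'
  have hr := aux_dpow a r
  have hs := aux_dpow a s
  have e : (X - C a) ^ (r + s) * (A1 * ((C (s : ℂ) - C (r : ℂ)) * P1 * Q1 +
      (X - C a) * (derivative Q1 * P1 - Q1 * derivative P1)) + B * P1 * Q1) = 0 := by
    rw [← hW, hP1, hQ1, derivative_mul, derivative_mul, pow_add]
    linear_combination (-A1 * Q1 * P1 * (X - C a) ^ r) * hs + (A1 * Q1 * P1 * (X - C a) ^ s) * hr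
  have e2 := (mul_eq_zero.1 e).resolve_left (pow_ne_zero _ (X_sub_C_ne_zero a))
  have e3 := congrArg (eval a) e2
  simp only [eval_add, eval_mul, eval_sub, eval_C, eval_X, eval_zero, hB, sub_self, zero_mul,
    add_zero] at e3
  have e4 : A1.eval a * P1.eval a * Q1.eval a * (s - r + α) = 0 := by
    linear_combination e3
  have e5 := (mul_eq_zero.1 e4).resolve_left (mul_ne_zero (mul_ne_zero hA1 hP1') hQ1')
  exact hα ((r : ℤ) - s) (by push_cast; linear_combination e5)

/-- Let `f ∈ 𝓛_A` with distinct branch points `a₁, …, a_p` (`p ≥ 2`),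
i.e. `f` is the branch at `∞` of `∏ (z − a_j)^{α_j}`, all `α_j ∈ ℂ∖ℤ`, `Σ α_j = 0`,
`f(∞) = 1`, satisfying `A f' = B f` with `A = ∏ (X − a_j)` and
`B = Σ_j α_j ∏_{i≠j} (X − a_i)`.  If `P_n, Q_n ∈ 𝒫_n`, `Q_n ≠ 0`, are Padé polynomials
of order `n` for `f` (so `R_n = Q_n f − P_n = O(z^{−(n+1)})` at `∞`), then `R_n ≢ 0` and
`R_n(z) = M_n z^{−(n+1+ℓ_n)} (1 + O(1/z))` with `M_n ≠ 0` and `0 ≤ ℓ_n ≤ p − 2`: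
all indices are almost perfect. -/
theorem stmt_9 (p : ℕ) (hp : 2 ≤ p) (a : Fin p → ℂ) (ha : Function.Injective a)
    (α : Fin p → ℂ) (hα : ∀ j, ∀ m : ℤ, α j ≠ (m : ℂ)) (hsum : ∑ j, α j = 0)
    (A B : Polynomial ℂ)
    (hA : A = ∏ j, (X - C (a j)))
    (hB : B = ∑ j, C (α j) * ∏ i ∈ Finset.univ.erase j, (X - C (a i)))
    (f : ℂ → ℂ) (R₀ : ℝ) (hR : ∀ j, ‖a j‖ < R₀)
    (hfd : DifferentiableOn ℂ f {z : ℂ | R₀ < ‖z‖})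
    (hf1 : Tendsto f (cobounded ℂ) (𝓝 1))
    (hfp : ∀ z ∈ {z : ℂ | R₀ < ‖z‖}, A.eval z * deriv f z = B.eval z * f z)
    (n : ℕ) (P Q : Polynomial ℂ) (hQ : Q ≠ 0)
    (hdegP : P.natDegree ≤ n) (hdegQ : Q.natDegree ≤ n)
    (hPade : (fun z : ℂ => Q.eval z * f z - P.eval z)
      =O[cobounded ℂ] fun z => (z ^ (n + 1))⁻¹) :
    ∃ (ℓ : ℕ) (M : ℂ), ℓ ≤ p - 2 ∧ M ≠ 0 ∧
      (fun z : ℂ => (Q.eval z * f z - P.eval z) - M / z ^ (n + 1 + ℓ))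
        =O[cobounded ℂ] fun z => (z ^ (n + 2 + ℓ))⁻¹ := by
  have hR0 : 0 < R₀ := (norm_nonneg _).trans_lt (hR ⟨0, by omega⟩)
  have hbig : ∀ᶠ z : ℂ in cobounded ℂ, R₀ < ‖z‖ :=
    tendsto_norm_cobounded_atTop.eventually_gt_atTop R₀
  have hopen : IsOpen {z : ℂ | R₀ < ‖z‖} := isOpen_lt continuous_const continuous_norm
  have hfat : ∀ z : ℂ, R₀ < ‖z‖ → DifferentiableAt ℂ f z := fun z hz =>
    hfd.differentiableAt (hopen.mem_nhds hz)
  have hpowinv : ∀ k m : ℕ, k < m →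
      Tendsto (fun z : ℂ => z ^ k * (z⁻¹) ^ m) (cobounded ℂ) (𝓝 0) := fun k m h =>
    (aux_powinv h).trans_tendsto aux_inv_tendsto
  have hR1 : Tendsto (fun z : ℂ => Q.eval z * f z - P.eval z) (cobounded ℂ) (𝓝 0) := by
    refine hPade.trans_tendsto ?_
    simpa using hpowinv 0 (n + 1) (by omega)
  -- P is nonzero
  have hP : P ≠ 0 := by
    rintro rfl
    apply hQ
    apply aux_poly_zero
    have h1 : (fun z : ℂ => Q.eval z * f z) =O[cobounded ℂ] fun z => z⁻¹ := by
      refine (IsBigO.trans (by simpa using hPade) ?_ :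
        (fun z : ℂ => Q.eval z * f z) =O[cobounded ℂ] fun z => z⁻¹)
      simpa using aux_powinv (k := 0) (m := n + 1) (by omega)
    have h2 : (fun z : ℂ => (f z)⁻¹) =O[cobounded ℂ] fun _ => (1 : ℂ) :=
      (hf1.inv₀ one_ne_zero).isBigO_one ℂ
    have h3 := h1.mul h2
    simp only [mul_one] at h3
    refine h3.congr' ?_ EventuallyEq.rfl
    filter_upwards [hf1.eventually_ne one_ne_zero] with z hz
    field_simp
  -- W is nonzero
  have hW : A * (derivative Q * P - Q * derivative P) + B * P * Q ≠ 0 := by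
    intro hW
    let j0 : Fin p := ⟨0, by omega⟩
    have hA' : A = (X - C (a j0)) * ∏ i ∈ Finset.univ.erase j0, (X - C (a i)) := by
      rw [hA]
      exact (Finset.mul_prod_erase _ (fun i => X - C (a i)) (Finset.mem_univ j0)).symm
    rw [hA'] at hW
    refine aux_W _ B P Q (a j0) (α j0) (hα j0) hP hQ ?_ ?_ hW
    · rw [eval_prod, Finset.prod_ne_zero_iff]
      intro i hi
      simp only [eval_sub, eval_X, eval_C, sub_ne_zero]
      exact fun h => (Finset.ne_of_mem_erase hi) (ha h).symm
    · rw [hB, eval_finsetSum, Finset.sum_eq_single j0]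
      · simp
      · intro j _ hj
        rw [eval_mul, eval_prod, Finset.prod_eq_zero (i := j0), mul_zero]
        · simp [hj.symm]
        · simp
      · simp
  have hAd : A.natDegree ≤ p := by
    rw [hA, natDegree_finsetProd_X_sub_C_eq_card]
    simp
  have hBd : B.natDegree ≤ p := by
    rw [hB]
    refine natDegree_sum_le_of_forall_le _ _ (fun j _ => ?_)
    refine (natDegree_C_mul_le _ _).trans ?_
    rw [natDegree_finsetProd_X_sub_C_eq_card]
    exact (Finset.card_le_univ _).trans (by simp)
  have hBd' : B.natDegree ≤ p - 1 := by
    rw [hB]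
    refine natDegree_sum_le_of_forall_le _ _ (fun j _ => ?_)
    refine (natDegree_C_mul_le _ _).trans ?_
    rw [natDegree_finsetProd_X_sub_C_eq_card]
    simp
  -- the function at zero
  set R : ℂ → ℂ := fun z => Q.eval z * f z - P.eval z with hRdef
  set g : ℂ → ℂ := Function.update (fun w => R w⁻¹) 0 0 with hg
  have hgR : ∀ z : ℂ, z ≠ 0 → g z⁻¹ = R z := by
    intro z hz
    rw [hg, Function.update_of_ne (inv_ne_zero hz), inv_inv]
  have hRd : ∀ z : ℂ, R₀ < ‖z‖ → HasDerivAt R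
      ((derivative Q).eval z * f z + Q.eval z * deriv f z - (derivative P).eval z) z := by
    intro z hz
    exact ((Q.hasDerivAt z).mul (hfat z hz).hasDerivAt).sub (P.hasDerivAt z)
  have hinvc : Tendsto (fun z : ℂ => z⁻¹) (𝓝[≠] 0) (cobounded ℂ) :=
    tendsto_inv₀_nhdsNE_zero
  have hgan : AnalyticAt ℂ g 0 := by
    refine Complex.analyticAt_of_differentiable_on_punctured_nhds_of_continuousAt ?_ ?_
    · filter_upwards [hinvc.eventually hbig, self_mem_nhdsWithin] with w hw hw0
      have hw0 : w ≠ 0 := hw0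
      have h1 : DifferentiableAt ℂ (fun w => R w⁻¹) w :=
        DifferentiableAt.comp w (hRd _ hw).differentiableAt (differentiableAt_inv hw0)
      refine h1.congr_of_eventuallyEq ?_
      filter_upwards [isOpen_ne.mem_nhds hw0] with u hu
      rw [hg, Function.update_of_ne hu]
    · rw [hg, continuousAt_update_same]
      exact hR1.comp hinvc
  -- transfer
  have htr : ∀ (N : ℕ) (h : ℂ → ℂ), (∀ᶠ w in 𝓝 0, g w = w ^ N * h w) →
      ∀ᶠ z in cobounded ℂ, R z = (z⁻¹) ^ N * h z⁻¹ := by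
    intro N h hh
    filter_upwards [aux_inv_tendsto.eventually hh, aux_ne0] with z hz hz0
    rw [← hgR z hz0, hz]
  -- key
  have key : ∀ (N : ℕ) (h : ℂ → ℂ), AnalyticAt ℂ h 0 → (∀ᶠ w in 𝓝 0, g w = w ^ N * h w) →
      n + p ≤ N → False := by
    intro N h hh hgN hN
    obtain ⟨N, rfl⟩ : ∃ K, N = K + 1 := ⟨N - 1, by omega⟩
    have hb : (fun z : ℂ => h z⁻¹) =O[cobounded ℂ] fun _ => (1 : ℂ) :=
      (hh.continuousAt.tendsto.comp aux_inv_tendsto).isBigO_one ℂ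
    have hb' : (fun z : ℂ => deriv h z⁻¹) =O[cobounded ℂ] fun _ => (1 : ℂ) :=
      (hh.deriv.continuousAt.tendsto.comp aux_inv_tendsto).isBigO_one ℂ
    have hi : (fun z : ℂ => z⁻¹) =O[cobounded ℂ] fun _ => (1 : ℂ) :=
      aux_inv_tendsto.isBigO_one ℂ
    have hRO : R =O[cobounded ℂ] fun z => (z⁻¹) ^ (N + 1) := by
      have := (isBigO_refl (fun z : ℂ => (z⁻¹) ^ (N + 1)) (cobounded ℂ)).mul hb
      simp only [mul_one] at this
      exact this.congr' ((htr _ _ hgN).mono fun z hz => hz.symm) EventuallyEq.rfl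
    have hdR : ∀ᶠ z in cobounded ℂ, deriv R z =
        (z⁻¹) ^ (N + 2) * (-(N + 1) * h z⁻¹ - z⁻¹ * deriv h z⁻¹) := by
      filter_upwards [aux_inv_tendsto.eventually hgN.eventually_nhds, aux_ne0,
        aux_inv_tendsto.eventually hh.eventually_analyticAt] with z hz hz0 hza
      have e1 : R =ᶠ[𝓝 z] fun y => (y⁻¹) ^ (N + 1) * h y⁻¹ := by
        filter_upwards [(continuousAt_inv₀ hz0).eventually hz, isOpen_ne.mem_nhds hz0] with y hy hy0
        rw [← hgR y hy0, hy]
      rw [e1.deriv_eq]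
      have d1 : HasDerivAt (fun y : ℂ => y⁻¹) (-(z ^ 2)⁻¹) z := hasDerivAt_inv hz0
      have d2 : HasDerivAt (fun y : ℂ => h y⁻¹) (deriv h z⁻¹ * (-(z ^ 2)⁻¹)) z :=
        HasDerivAt.comp z hza.differentiableAt.hasDerivAt d1
      refine ((d1.pow (N + 1)).mul d2).deriv.trans ?_
      simp only [Pi.pow_apply, Nat.add_sub_cancel]
      push_cast
      simp only [← inv_pow]
      ring
    have hdRO : (deriv R) =O[cobounded ℂ] fun z => (z⁻¹) ^ (N + 2) := by
      have h1 : (fun z : ℂ => (-(N + 1) * h z⁻¹ - z⁻¹ * deriv h z⁻¹)) =O[cobounded ℂ]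
          fun _ => (1 : ℂ) := by
        refine (hb.const_mul_left _).sub ?_
        simpa using hi.mul hb'
      have := (isBigO_refl (fun z : ℂ => (z⁻¹) ^ (N + 2)) (cobounded ℂ)).mul h1
      simp only [mul_one] at this
      exact this.congr' (hdR.mono fun z hz => hz.symm) EventuallyEq.rfl
    apply hW
    apply aux_poly_zero
    have t1 : (fun z : ℂ => A.eval z * Q.eval z * deriv R z) =O[cobounded ℂ] fun z => z⁻¹ := by
      refine (((aux_poly A hAd).mul (aux_poly Q hdegQ)).mul hdRO).trans ?_
      simp only [← pow_add]
      exact aux_powinv (by omega)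
    have t3 : (fun z : ℂ => B.eval z * Q.eval z * R z) =O[cobounded ℂ] fun z => z⁻¹ := by
      refine (((aux_poly B hBd').mul (aux_poly Q hdegQ)).mul hRO).trans ?_
      simp only [← pow_add]
      exact aux_powinv (by omega)
    have t2 : (fun z : ℂ => A.eval z * (derivative Q).eval z * R z)
        =O[cobounded ℂ] fun z => z⁻¹ := by
      rcases Nat.eq_zero_or_pos n with hn | hn
      · have : derivative Q = 0 := by
          apply derivative_of_natDegree_zero
          omega
        simp only [this, eval_zero, mul_zero, zero_mul]
        exact isBigO_zero _ _
      · have hd : (derivative Q).natDegree ≤ n - 1 :=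
          (natDegree_derivative_le Q).trans (by omega)
        refine (((aux_poly A hAd).mul (aux_poly _ hd)).mul hRO).trans ?_
        simp only [← pow_add]
        exact aux_powinv (by omega)
    refine ((t1.sub t2).sub t3).congr' ?_ EventuallyEq.rfl
    filter_upwards [hbig] with z hz
    rw [(hRd z hz).deriv, hRdef]
    simp only [eval_add, eval_mul, eval_sub]
    linear_combination (Q.eval z) ^ 2 * hfp z hz
  -- conclusion
  have hne : ¬ ∀ᶠ w in 𝓝 0, g w = 0 := by
    intro h0
    refine key (n + p) (fun _ => 0) analyticAt_const ?_ le_rfl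
    simpa using h0
  obtain ⟨N, h, hh, hh0, hgN⟩ := hgan.exists_eventuallyEq_pow_smul_nonzero_iff.2 hne
  simp only [sub_zero, smul_eq_mul] at hgN
  have hN1 : N < n + p := by
    by_contra hcon
    exact key N h hh hgN (not_lt.1 hcon)
  have hRN := htr N h hgN
  have hN2 : n + 1 ≤ N := by
    by_contra hcon
    have l1 : Tendsto (fun z : ℂ => h z⁻¹) (cobounded ℂ) (𝓝 (h 0)) :=
      hh.continuousAt.tendsto.comp aux_inv_tendsto
    have l2 : Tendsto (fun z : ℂ => z ^ N * R z) (cobounded ℂ) (𝓝 0) := by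
      refine ((isBigO_refl (fun z : ℂ => z ^ N) _).mul hPade).trans_tendsto ?_
      simpa using hpowinv N (n + 1) (by omega)
    refine hh0 (tendsto_nhds_unique l1 (l2.congr' ?_))
    filter_upwards [hRN, aux_ne0] with z hz hz0
    rw [hz, ← mul_assoc, ← mul_pow, mul_inv_cancel₀ hz0, one_pow, one_mul]
  refine ⟨N - (n + 1), h 0, by omega, hh0, ?_⟩
  rw [show n + 1 + (N - (n + 1)) = N by omega, show n + 2 + (N - (n + 1)) = N + 1 by omega]
  have o1 : (fun w : ℂ => h w - h 0) =O[𝓝 0] fun w => w := by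
    simpa using hh.differentiableAt.isBigO_sub
  have o2 := (isBigO_refl (fun z : ℂ => (z⁻¹) ^ N) _).mul (o1.comp_tendsto aux_inv_tendsto)
  refine o2.congr' ?_ ?_
  · filter_upwards [hRN] with z hz
    change _ = R z - _
    rw [hz]
    simp only [Function.comp, div_eq_mul_inv, inv_pow]
    ring
  · refine Eventually.of_forall fun z => ?_
    simp only [Function.comp, inv_pow, pow_succ, mul_inv]
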